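/- Streaming equation (exact form): for every N ∈ ℕ, α > 0, β > 0, s ≥ 1 and every function F_s : ({−1,1}^N)^s → ℝ of s replica configurations, the map t ↦ ⟨F_s⟩_{N,t} is differentiable on [0,1] and ∂_t ⟨F_s⟩_{N,t} = 2α · E[ Ω̃_t( F_s · exp(β ∑_{a=1}^s σ^{(a)}_{i₀}) ) / ( ω̃_t(exp(β σ_{i₀})) )^s − Ω̃_t(F_s) ], where i₀ is a further index uniformly distributed on {1,…,N}, independent of everything else, and E includes the average over i₀. -/

import Mathlib

open scoped BigOperators

noncomputable section

/-- The Poisson probability mass function with mean `lam`. -/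
def pois (lam : ℝ) (k : ℕ) : ℝ := Real.exp (-lam) * lam ^ k / (Nat.factorial k)

/-- The spin value (±1) attached to a Boolean opinion. -/
def spin (b : Bool) : ℝ := if b then 1 else -1

/-- Average of `f` over `p` families of `k` i.i.d. indices, each uniform on `Fin N`. -/
def avgIdx (N : ℕ) (p k : ℕ) (f : (Fin p → Fin k → Fin N) → ℝ) : ℝ :=
  ((N : ℝ) ^ (p * k))⁻¹ * ∑ im : Fin p → Fin k → Fin N, f im

/-- The interaction sum `∑_{ν=1}^k σ_{i_ν^1} ⋯ σ_{i_ν^p}`; the Hamiltonian is its negative. -/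
def intSum {N p k : ℕ} (im : Fin p → Fin k → Fin N) (σ : Fin N → Bool) : ℝ :=
  ∑ ν : Fin k, ∏ l : Fin p, spin (σ (im l ν))

/-- The diluted `p`-spin Hamiltonian `H = -∑_{ν=1}^k σ_{i_ν^1} ⋯ σ_{i_ν^p}`. -/
def Hspin {N p k : ℕ} (im : Fin p → Fin k → Fin N) (σ : Fin N → Bool) : ℝ :=
  - intSum im σ

/-- Partition function `Z = ∑_σ e^{-β H(σ)}`. -/
def Zpart (β : ℝ) {N p k : ℕ} (im : Fin p → Fin k → Fin N) : ℝ :=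
  ∑ σ : Fin N → Bool, Real.exp (β * intSum im σ)

/-- Cavity term `∑_{ν=1}^{k'} σ_{i_ν^1} ⋯ σ_{i_ν^q}` (with `q = p - 1` families). -/
def cavSum {N q k' : ℕ} (im' : Fin q → Fin k' → Fin N) (σ : Fin N → Bool) : ℝ :=
  ∑ ν : Fin k', ∏ l : Fin q, spin (σ (im' l ν))

/-- Perturbed Boltzmann weight `exp(β(∑_ν σ_{i_ν^1}⋯σ_{i_ν^p} + ∑_ν σ_{i'_ν^1}⋯σ_{i'_ν^{q}}))`. -/
def wpert (β : ℝ) {N p k q k' : ℕ} (im : Fin p → Fin k → Fin N)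
    (im' : Fin q → Fin k' → Fin N) (σ : Fin N → Bool) : ℝ :=
  Real.exp (β * (intSum im σ + cavSum im' σ))

/-- Perturbed partition function. -/
def Zpert (β : ℝ) {N p k q k' : ℕ} (im : Fin p → Fin k → Fin N)
    (im' : Fin q → Fin k' → Fin N) : ℝ :=
  ∑ σ : Fin N → Bool, wpert β im im' σ

/-- Replicated (unperturbed) Boltzmann state `Ω(g)` on `s` replicas sharing the same disorder. -/
def OmegaB (β : ℝ) {N p k : ℕ} (im : Fin p → Fin k → Fin N)
    (s : ℕ) (g : (Fin s → Fin N → Bool) → ℝ) : ℝ :=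
  (∑ σs : Fin s → Fin N → Bool, g σs * ∏ a : Fin s, Real.exp (β * intSum im (σs a))) /
    (Zpart β im) ^ s

/-- Replicated perturbed Boltzmann state `Ω̃_t(g)` on `s` replicas sharing the same disorder. -/
def OmegaPert (β : ℝ) {N p k q k' : ℕ} (im : Fin p → Fin k → Fin N)
    (im' : Fin q → Fin k' → Fin N) (s : ℕ) (g : (Fin s → Fin N → Bool) → ℝ) : ℝ :=
  (∑ σs : Fin s → Fin N → Bool, g σs * ∏ a : Fin s, wpert β im im' (σs a)) /
    (Zpert β im im') ^ s

/-- Quenched expectation: the number of interaction terms is Poisson of mean `γ N` and the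
`p` index families are i.i.d. uniform on `Fin N`. -/
def Equench (N p : ℕ) (γ : ℝ) (f : (k : ℕ) → (Fin p → Fin k → Fin N) → ℝ) : ℝ :=
  ∑' k : ℕ, pois (γ * N) k * avgIdx N p k (fun im => f k im)

/-- Quenched expectation including the cavity randomness: the cavity term has a Poisson
number of terms of mean `2 γ t`, with `p - 1` independent uniform index families. -/
def EquenchCav (N p : ℕ) (γ t : ℝ)
    (f : (k : ℕ) → (Fin p → Fin k → Fin N) →
         (k' : ℕ) → (Fin (p - 1) → Fin k' → Fin N) → ℝ) : ℝ :=
  ∑' k : ℕ, pois (γ * N) k * avgIdx N p k (fun im =>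
    ∑' k' : ℕ, pois (2 * γ * t) k' * avgIdx N (p - 1) k' (fun im' => f k im k' im'))

/-- Quenched average of `ln Z_N`. -/
def ElnZ (N p : ℕ) (γ β : ℝ) : ℝ :=
  Equench N p γ (fun _ im => Real.log (Zpart β im))

/-- Quenched pressure `A_N = (1/N) E[ln Z_N]`. -/
def pressure (N p : ℕ) (γ β : ℝ) : ℝ :=
  (N : ℝ)⁻¹ * ElnZ N p γ β

/-- Cavity function `Ψ_N(t) = E[ln (Z_{N,t} / Z_N)]`. -/
def cavityFn (N p : ℕ) (γ β t : ℝ) : ℝ :=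
  EquenchCav N p γ t (fun _ im _ im' => Real.log (Zpert β im im' / Zpart β im))

/-- The multi-overlap `q_{1…n} = (1/N) ∑_i σ_i^{(1)} ⋯ σ_i^{(n)}` of `n` replicas. -/
def qOv (N n : ℕ) (σs : Fin n → Fin N → Bool) : ℝ :=
  (N : ℝ)⁻¹ * ∑ x : Fin N, ∏ a : Fin n, spin (σs a x)

/-- Total (quenched) average `⟨q_{1…n}^r⟩_N` of the `r`-th power of the `n`-replica overlap. -/
def qPowAvg (N p : ℕ) (γ β : ℝ) (n r : ℕ) : ℝ :=
  Equench N p γ (fun _ im => OmegaB β im n (fun σs => (qOv N n σs) ^ r))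

/-- Perturbed total average `⟨q_{1…n}^r⟩_{N,t}` of the `r`-th power of the `n`-replica overlap. -/
def qPowAvgPert (N p : ℕ) (γ β t : ℝ) (n r : ℕ) : ℝ :=
  EquenchCav N p γ t (fun _ im _ im' => OmegaPert β im im' n (fun σs => (qOv N n σs) ^ r))

end

lemma abs_pois (x : ℝ) (k : ℕ) :
    |pois x k| = Real.exp (-x) * (|x| ^ k / (k.factorial : ℝ)) := by
  rw [pois, abs_div, abs_mul, abs_pow, Real.abs_exp, Nat.abs_cast, mul_div_assoc]

lemma summable_abs_pois (x : ℝ) : Summable fun k => |pois x k| := by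
  simp only [abs_pois]
  exact (Real.summable_pow_div_factorial |x|).mul_left _

lemma summable_pois_mul (x : ℝ) {h : ℕ → ℝ} {C : ℝ} (hC : ∀ k, |h k| ≤ C) :
    Summable fun k => pois x k * h k := by
  refine Summable.of_norm_bounded ((summable_abs_pois x).mul_right C) fun k => ?_
  rw [Real.norm_eq_abs, abs_mul]
  exact mul_le_mul_of_nonneg_left (hC k) (abs_nonneg _)

lemma hasDerivAt_tsum_pow_div_factorial_mul {h : ℕ → ℝ} {C : ℝ} (hC : ∀ k, |h k| ≤ C) (x : ℝ) :
    HasDerivAt (fun y : ℝ => ∑' k : ℕ, y ^ k / (k.factorial : ℝ) * h k)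
      (∑' k : ℕ, x ^ k / (k.factorial : ℝ) * h (k + 1)) x := by
  set R : ℝ := |x| + 1
  have hsucc (y : ℝ) (k : ℕ) :
      ((k + 1 : ℕ) : ℝ) * y ^ (k + 1 - 1) / ((k + 1).factorial : ℝ) =
        y ^ k / (k.factorial : ℝ) := by
    rw [Nat.factorial_succ, Nat.add_sub_cancel, Nat.cast_mul]
    exact mul_div_mul_left _ _ (by positivity)
  have hu : Summable fun k : ℕ => (k : ℝ) * R ^ (k - 1) / (k.factorial : ℝ) * C := by
    rw [← summable_nat_add_iff 1]
    simp only [hsucc]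
    exact (Real.summable_pow_div_factorial R).mul_right C
  have hxR : x ∈ Metric.ball (0 : ℝ) R := by simp [R]
  have hbound (k : ℕ) (y : ℝ) (hy : y ∈ Metric.ball (0 : ℝ) R) :
      ‖(k : ℝ) * y ^ (k - 1) / (k.factorial : ℝ) * h k‖ ≤
        (k : ℝ) * R ^ (k - 1) / (k.factorial : ℝ) * C := by
    have hy' : |y| ≤ R := by simpa using (mem_ball_zero_iff.mp hy).le
    rw [Real.norm_eq_abs, abs_mul, abs_div, abs_mul, abs_pow, Nat.abs_cast, Nat.abs_cast]
    gcongr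
    exact hC k
  have hx0 : Summable fun k : ℕ => x ^ k / (k.factorial : ℝ) * h k := by
    refine Summable.of_norm_bounded ((Real.summable_pow_div_factorial |x|).mul_right C)
      fun k => ?_
    rw [Real.norm_eq_abs, abs_mul, abs_div, abs_pow, Nat.abs_cast]
    gcongr
    exact hC k
  have key := hasDerivAt_tsum_of_isPreconnected
    (g := fun (k : ℕ) (y : ℝ) => y ^ k / (k.factorial : ℝ) * h k)
    (g' := fun (k : ℕ) (y : ℝ) => (k : ℝ) * y ^ (k - 1) / (k.factorial : ℝ) * h k)
    hu Metric.isOpen_ball (convex_ball (0 : ℝ) R).isPreconnected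
    (fun k y _ => ((hasDerivAt_pow k y).div_const _).mul_const _) hbound hxR hx0 hxR
  rw [(Summable.of_norm_bounded hu fun k => hbound k x hxR).tsum_eq_zero_add] at key
  simp only [hsucc] at key
  simpa using key

/-- Differentiating a Poisson average in its mean gives the average of the forward difference. -/
lemma hasDerivAt_tsum_pois_mul {h : ℕ → ℝ} {C : ℝ} (hC : ∀ k, |h k| ≤ C) (x : ℝ) :
    HasDerivAt (fun y : ℝ => ∑' k : ℕ, pois y k * h k)
      (∑' k : ℕ, pois x k * (h (k + 1) - h k)) x := by
  have hpois (y : ℝ) (g : ℕ → ℝ) :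
      ∑' k : ℕ, pois y k * g k = Real.exp (-y) * ∑' k : ℕ, y ^ k / (k.factorial : ℝ) * g k := by
    rw [← tsum_mul_left]
    exact tsum_congr fun k => by rw [pois]; ring
  have hd := ((hasDerivAt_neg x).exp).mul (hasDerivAt_tsum_pow_div_factorial_mul hC x)
  simp only [mul_sub]
  rw [(summable_pois_mul x fun k => hC (k + 1)).tsum_sub (summable_pois_mul x hC)]
  simp only [hpois]
  exact hd.congr_deriv (by ring)

lemma abs_avgIdx_le {N p k : ℕ} (hN : 0 < N) {f : (Fin p → Fin k → Fin N) → ℝ} {C : ℝ}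
    (hC : ∀ im, |f im| ≤ C) : |avgIdx N p k f| ≤ C := by
  have hpos : (0 : ℝ) < (N : ℝ) ^ (p * k) := by positivity
  have hsum : |∑ im, f im| ≤ (N : ℝ) ^ (p * k) * C := by
    refine (Finset.abs_sum_le_sum_abs _ _).trans ((Finset.sum_le_sum fun im _ => hC im).trans ?_)
    simp [← pow_mul, mul_comm p k]
  rw [avgIdx, abs_mul, abs_of_pos (inv_pos.mpr hpos)]
  exact (inv_mul_le_iff₀ hpos).mpr hsum

lemma avgIdx_sub {N p k : ℕ} (f g : (Fin p → Fin k → Fin N) → ℝ) :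
    avgIdx N p k (fun im => f im - g im) = avgIdx N p k f - avgIdx N p k g := by
  simp only [avgIdx, Finset.sum_sub_distrib, mul_sub]

lemma avgIdx_tsum {N p k : ℕ} {f : (Fin p → Fin k → Fin N) → ℕ → ℝ}
    (hf : ∀ im, Summable (f im)) :
    avgIdx N p k (fun im => ∑' n, f im n) = ∑' n, avgIdx N p k (fun im => f im n) := by
  simp only [avgIdx]
  rw [tsum_mul_left, Summable.tsum_finsetSum fun im _ => hf im]

lemma avgIdx_mul_left {N p k : ℕ} (c : ℝ) (f : (Fin p → Fin k → Fin N) → ℝ) :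
    avgIdx N p k (fun im => c * f im) = c * avgIdx N p k f := by
  simp only [avgIdx, ← Finset.mul_sum]
  ring

lemma abs_Equench_le {N p : ℕ} (hN : 0 < N) (γ : ℝ)
    {f : (k : ℕ) → (Fin p → Fin k → Fin N) → ℝ} {C : ℝ} (hC : ∀ k im, |f k im| ≤ C) :
    |Equench N p γ f| ≤ ∑' k, |pois (γ * N) k| * C := by
  rw [Equench, ← Real.norm_eq_abs]
  refine tsum_of_norm_bounded ((summable_abs_pois _).mul_right C).hasSum fun k => ?_
  rw [Real.norm_eq_abs, abs_mul]
  exact mul_le_mul_of_nonneg_left (abs_avgIdx_le hN (hC k)) (abs_nonneg _)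

lemma Equench_sub {N p : ℕ} (hN : 0 < N) (γ : ℝ)
    {f g : (k : ℕ) → (Fin p → Fin k → Fin N) → ℝ} {C D : ℝ}
    (hC : ∀ k im, |f k im| ≤ C) (hD : ∀ k im, |g k im| ≤ D) :
    Equench N p γ (fun k im => f k im - g k im) = Equench N p γ f - Equench N p γ g := by
  simp only [Equench, avgIdx_sub, mul_sub]
  exact (summable_pois_mul _ fun k => abs_avgIdx_le hN (hC k)).tsum_sub
    (summable_pois_mul _ fun k => abs_avgIdx_le hN (hD k))

/-- For bounded observables the average over the number of cavity terms can be taken last. -/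
lemma EquenchCav_eq_tsum {N p : ℕ} (hN : 0 < N) (γ t : ℝ)
    {f : (k : ℕ) → (Fin p → Fin k → Fin N) →
      (k' : ℕ) → (Fin (p - 1) → Fin k' → Fin N) → ℝ} {C : ℝ}
    (hC : ∀ k im k' im', |f k im k' im'| ≤ C) :
    EquenchCav N p γ t f = ∑' k' : ℕ, pois (2 * γ * t) k' *
      Equench N p γ (fun k im => avgIdx N (p - 1) k' (f k im k')) := by
  have hav (k im k') : |avgIdx N (p - 1) k' (f k im k')| ≤ C :=
    abs_avgIdx_le hN (hC k im k')
  have hsum : Summable (Function.uncurry fun k k' : ℕ => pois (γ * N) k *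
      (pois (2 * γ * t) k' *
        avgIdx N p k (fun im => avgIdx N (p - 1) k' (f k im k')))) := by
    refine Summable.of_norm_bounded (((summable_abs_pois (γ * N)).mul_of_nonneg
      (summable_abs_pois (2 * γ * t)) (fun _ => abs_nonneg _) fun _ => abs_nonneg _).mul_right C)
      fun x => ?_
    rw [Function.uncurry, Real.norm_eq_abs, abs_mul, abs_mul, ← mul_assoc]
    exact mul_le_mul_of_nonneg_left (abs_avgIdx_le hN fun im => hav _ im _) (by positivity)
  calc EquenchCav N p γ t f
      = ∑' k : ℕ, ∑' k' : ℕ, pois (γ * N) k * (pois (2 * γ * t) k' *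
          avgIdx N p k (fun im => avgIdx N (p - 1) k' (f k im k'))) := by
        refine tsum_congr fun k => ?_
        rw [avgIdx_tsum fun im => summable_pois_mul _ (hav k im), ← tsum_mul_left]
        simp only [avgIdx_mul_left]
    _ = ∑' k' : ℕ, ∑' k : ℕ, pois (γ * N) k * (pois (2 * γ * t) k' *
          avgIdx N p k (fun im => avgIdx N (p - 1) k' (f k im k'))) := hsum.tsum_comm.symm
    _ = _ := by
        refine tsum_congr fun k' => ?_
        rw [Equench, ← tsum_mul_left]
        exact tsum_congr fun k => by ring

lemma avgIdx_one_succ {N k : ℕ} (f : (Fin 1 → Fin (k + 1) → Fin N) → ℝ) :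
    avgIdx N 1 (k + 1) f = avgIdx N 1 k fun im =>
      (N : ℝ)⁻¹ * ∑ i : Fin N, f fun l => Fin.cons i (im l) := by
  have hsum : ∑ im : Fin 1 → Fin (k + 1) → Fin N, f im =
      ∑ im : Fin 1 → Fin k → Fin N, ∑ i : Fin N, f fun l => Fin.cons i (im l) := by
    rw [← (Equiv.funUnique (Fin 1) (Fin (k + 1) → Fin N)).symm.sum_comp,
      ← (Equiv.funUnique (Fin 1) (Fin k → Fin N)).symm.sum_comp,
      ← (Fin.consEquiv fun _ : Fin (k + 1) => Fin N).sum_comp, Fintype.sum_prod_type,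
      Finset.sum_comm]
    rfl
  simp only [avgIdx, hsum, ← Finset.mul_sum, one_mul, pow_succ, mul_inv, mul_assoc]

lemma wpert_cons (β : ℝ) {N p k k' : ℕ} (im : Fin p → Fin k → Fin N)
    (im' : Fin 1 → Fin k' → Fin N) (i : Fin N) (σ : Fin N → Bool) :
    wpert β im (fun l => Fin.cons i (im' l) : Fin 1 → Fin (k' + 1) → Fin N) σ =
      Real.exp (β * spin (σ i)) * wpert β im im' σ := by
  simp only [wpert, cavSum, ← Real.exp_add, Fin.sum_univ_succ, Fin.cons_zero, Fin.cons_succ,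
    Finset.univ_unique, Finset.prod_singleton]
  congr 1
  ring

lemma Zpert_pos (β : ℝ) {N p k q k' : ℕ} (im : Fin p → Fin k → Fin N)
    (im' : Fin q → Fin k' → Fin N) : 0 < Zpert β im im' :=
  Finset.sum_pos (fun _ _ => Real.exp_pos _) Finset.univ_nonempty

lemma abs_OmegaPert_le (β : ℝ) {N p k q k' : ℕ} (im : Fin p → Fin k → Fin N)
    (im' : Fin q → Fin k' → Fin N) (s : ℕ) (F : (Fin s → Fin N → Bool) → ℝ) :
    |OmegaPert β im im' s F| ≤ ∑ σs, |F σs| := by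
  have hZ : 0 < Zpert β im im' ^ s := pow_pos (Zpert_pos β im im') s
  have hw (σ : Fin N → Bool) : 0 ≤ wpert β im im' σ := (Real.exp_pos _).le
  rw [OmegaPert, abs_div, abs_of_pos hZ, div_le_iff₀ hZ, Finset.sum_mul]
  refine (Finset.abs_sum_le_sum_abs _ _).trans (Finset.sum_le_sum fun σs _ => ?_)
  rw [abs_mul, abs_of_nonneg (Finset.prod_nonneg fun a _ => hw (σs a))]
  refine mul_le_mul_of_nonneg_left ?_ (abs_nonneg _)
  calc ∏ a, wpert β im im' (σs a) ≤ ∏ _a : Fin s, Zpert β im im' :=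
        Finset.prod_le_prod (fun a _ => hw (σs a)) fun a _ =>
          Finset.single_le_sum (fun σ _ => hw σ) (Finset.mem_univ (σs a))
    _ = Zpert β im im' ^ s := by simp

lemma OmegaPert_one_exp_spin (β : ℝ) {N p k k' : ℕ} (im : Fin p → Fin k → Fin N)
    (im' : Fin 1 → Fin k' → Fin N) (i : Fin N) :
    OmegaPert β im im' 1 (fun σ => Real.exp (β * spin (σ 0 i))) =
      Zpert β im (fun l => Fin.cons i (im' l) : Fin 1 → Fin (k' + 1) → Fin N) /
        Zpert β im im' := by
  rw [OmegaPert, pow_one, Zpert]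
  congr 1
  rw [← (Equiv.funUnique (Fin 1) (Fin N → Bool)).symm.sum_comp]
  refine Finset.sum_congr rfl fun σ _ => ?_
  rw [wpert_cons]
  simp

/-- Adding one cavity term reweights the Boltzmann state by the corresponding factor. -/
lemma OmegaPert_cons (β : ℝ) {N p k k' : ℕ} (im : Fin p → Fin k → Fin N)
    (im' : Fin 1 → Fin k' → Fin N) (s : ℕ) (F : (Fin s → Fin N → Bool) → ℝ) (i : Fin N) :
    OmegaPert β im im' s (fun σs => F σs * Real.exp (β * ∑ a : Fin s, spin (σs a i))) /
        (OmegaPert β im im' 1 (fun σ => Real.exp (β * spin (σ 0 i)))) ^ s =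
      OmegaPert β im (fun l => Fin.cons i (im' l) : Fin 1 → Fin (k' + 1) → Fin N) s F := by
  have hZ : Zpert β im im' ^ s ≠ 0 := (pow_pos (Zpert_pos β im im') s).ne'
  rw [OmegaPert_one_exp_spin, OmegaPert, OmegaPert, div_pow, div_div_div_cancel_right₀ hZ]
  congr 1
  refine Finset.sum_congr rfl fun σs _ => ?_
  simp only [wpert_cons, Finset.prod_mul_distrib, ← Real.exp_sum, ← Finset.mul_sum]
  ring

/-- Exact streaming equation for the diluted Curie–Weiss model (`p = 2`, `γ = α`): for every
function `F` of `s` replica configurations, the map `t ↦ ⟨F⟩_{N,t}` is differentiable on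
`[0,1]` and
`∂_t ⟨F⟩_{N,t} = 2α E[ Ω̃_t(F · e^{β ∑_a σ^{(a)}_{i₀}}) / (ω̃_t(e^{β σ_{i₀}}))^s - Ω̃_t(F) ]`,
where `i₀` is a further uniform index on `{1,…,N}` and `E` includes the average over `i₀`. -/
theorem streaming_equation (N : ℕ) (hN : 0 < N) (α β : ℝ) (hα : 0 < α) (hβ : 0 < β)
    (s : ℕ) (hs : 1 ≤ s) (F : (Fin s → Fin N → Bool) → ℝ)
    (t : ℝ) (ht : t ∈ Set.Icc (0 : ℝ) 1) :
    HasDerivAt (fun t' : ℝ => EquenchCav N 2 α t' (fun _ im _ im' => OmegaPert β im im' s F))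
      (2 * α * EquenchCav N 2 α t (fun _ im _ im' =>
        (N : ℝ)⁻¹ * ∑ i0 : Fin N,
          (OmegaPert β im im' s
              (fun σs => F σs * Real.exp (β * ∑ a : Fin s, spin (σs a i0))) /
            (OmegaPert β im im' 1 (fun σ1 => Real.exp (β * spin (σ1 0 i0)))) ^ s
          - OmegaPert β im im' s F))) t := by
  set C : ℝ := ∑ σs, |F σs|
  set A : ℕ → ℝ := fun k' =>
    Equench N 2 α (fun k im => avgIdx N 1 k' (fun im' => OmegaPert β im im' s F)) with hA
  have hbound (k) (im : Fin 2 → Fin k → Fin N) (k') (im' : Fin 1 → Fin k' → Fin N) :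
      |OmegaPert β im im' s F| ≤ C := abs_OmegaPert_le β im im' s F
  have havg (k) (im : Fin 2 → Fin k → Fin N) (k') :
      |avgIdx N 1 k' (fun im' => OmegaPert β im im' s F)| ≤ C :=
    abs_avgIdx_le hN (hbound k im k')
  have hAbound (k' : ℕ) : |A k'| ≤ ∑' k, |pois (α * N) k| * C :=
    abs_Equench_le hN α fun k im => havg k im k'
  have hN0 : (N : ℝ) ≠ 0 := Nat.cast_ne_zero.mpr hN.ne'
  have hmean (k) (im : Fin 2 → Fin k → Fin N) (k') (im' : Fin 1 → Fin k' → Fin N) :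
      (N : ℝ)⁻¹ * ∑ i0 : Fin N,
          (OmegaPert β im im' s
              (fun σs => F σs * Real.exp (β * ∑ a : Fin s, spin (σs a i0))) /
            (OmegaPert β im im' 1 (fun σ1 => Real.exp (β * spin (σ1 0 i0)))) ^ s
          - OmegaPert β im im' s F) =
        (N : ℝ)⁻¹ * ∑ i0 : Fin N, OmegaPert β im
          (fun l => Fin.cons i0 (im' l) : Fin 1 → Fin (k' + 1) → Fin N) s F -
        OmegaPert β im im' s F := by
    simp only [OmegaPert_cons, Finset.sum_sub_distrib, Finset.sum_const, Finset.card_univ,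
      Fintype.card_fin, nsmul_eq_mul, mul_sub, inv_mul_cancel_left₀ hN0]
  have hmeanBound (k) (im : Fin 2 → Fin k → Fin N) (k') (im' : Fin 1 → Fin k' → Fin N) :
      |(N : ℝ)⁻¹ * ∑ i0 : Fin N, OmegaPert β im
          (fun l => Fin.cons i0 (im' l) : Fin 1 → Fin (k' + 1) → Fin N) s F -
        OmegaPert β im im' s F| ≤ C + C := by
    refine (abs_sub _ _).trans (add_le_add ?_ (hbound k im k' im'))
    rw [abs_mul, abs_inv, Nat.abs_cast, inv_mul_le_iff₀ (by positivity)]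
    refine (Finset.abs_sum_le_sum_abs _ _).trans
      ((Finset.sum_le_sum fun i0 _ => hbound k im _ _).trans ?_)
    simp
  have hleft : (fun t' : ℝ => EquenchCav N 2 α t' (fun _ im _ im' => OmegaPert β im im' s F)) =
      fun t' : ℝ => ∑' k' : ℕ, pois (2 * α * t') k' * A k' :=
    funext fun t' => EquenchCav_eq_tsum hN α t' hbound
  have hdiff (k' : ℕ) : Equench N 2 α (fun k im => avgIdx N 1 k' fun im' =>
      (N : ℝ)⁻¹ * ∑ i0 : Fin N, OmegaPert β im
          (fun l => Fin.cons i0 (im' l) : Fin 1 → Fin (k' + 1) → Fin N) s F -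
        OmegaPert β im im' s F) = A (k' + 1) - A k' := by
    simp only [hA, avgIdx_sub]
    rw [← Equench_sub hN α (fun k im => havg k im (k' + 1)) (fun k im => havg k im k')]
    simp only [avgIdx_one_succ]
  simp only [hmean]
  rw [hleft, EquenchCav_eq_tsum hN α t hmeanBound]
  simp only [Nat.add_one_sub_one, hdiff]
  have hlin : HasDerivAt (fun t' : ℝ => 2 * α * t') (2 * α) t := by
    simpa using (hasDerivAt_id t).const_mul (2 * α)
  rw [mul_comm (2 * α) (∑' _, _)]
  exact (hasDerivAt_tsum_pois_mul hAbound (2 * α * t)).comp t hlin
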